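/- Assume (H1)-(H2), and let x_⋆ ∈ ℝⁿ satisfy x_⋆ ≤ g for all g ∈ Γ. Let B be an unordered connected component of 𝓑(Φ). Define B₁ = {x ∈ B : there exist a sequence z_n → x with x ≪ z_n for all n, and equilibria q_n ∈ α(z_n) ∩ E with x < q_n for all n} and B₂ = {x ∈ B : there exists a sequence z_n ∈ R₋(+∞) with z_n → x and x ≪ z_n for all n}. Then: (i) if B₁ ≠ ∅ then B₂ = ∅, and if B₂ ≠ ∅ then B₁ = ∅; (ii) if B₁ ≠ ∅ then B₁ is dense in B, and if B₂ ≠ ∅ then B₂ is dense in B. -/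

import Mathlib

open Set Metric Filter Topology Pointwise

noncomputable section

abbrev Euc (n : ℕ) := EuclideanSpace ℝ (Fin n)

/-- `Φ` is a continuous flow on `ℝⁿ`. -/
def IsFlow {n : ℕ} (Φ : ℝ → Euc n → Euc n) : Prop :=
  Continuous (fun p : ℝ × Euc n => Φ p.1 p.2) ∧
  (∀ x, Φ 0 x = x) ∧
  (∀ t s x, Φ t (Φ s x) = Φ (t + s) x)

/-- `Cp` is a closed, solid, salient convex cone. -/
def IsConeOrder {n : ℕ} (Cp : Set (Euc n)) : Prop :=
  IsClosed Cp ∧ (∀ x ∈ Cp, ∀ y ∈ Cp, x + y ∈ Cp) ∧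
  (∀ α : ℝ, 0 < α → ∀ x ∈ Cp, α • x ∈ Cp) ∧
  (interior Cp).Nonempty ∧ Cp ∩ (-Cp) = {0}

/-- `x ≤ y` iff `y - x ∈ C⁺`. -/
def coneLe {n : ℕ} (Cp : Set (Euc n)) (x y : Euc n) : Prop := y - x ∈ Cp

/-- `x < y` iff `y - x ∈ C⁺ \ {0}`. -/
def coneLt {n : ℕ} (Cp : Set (Euc n)) (x y : Euc n) : Prop := y - x ∈ Cp ∧ y ≠ x

/-- `x ≪ y` iff `y - x ∈ Int C⁺`. -/
def coneLL {n : ℕ} (Cp : Set (Euc n)) (x y : Euc n) : Prop := y - x ∈ interior Cp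

/-- `S` is unordered: no two distinct points related by `≤`. -/
def Unordered {n : ℕ} (Cp : Set (Euc n)) (S : Set (Euc n)) : Prop :=
  ∀ x ∈ S, ∀ y ∈ S, x ≠ y → ¬ coneLe Cp x y

/-- (H1): `Φ` is strongly competitive. -/
def StronglyCompetitive {n : ℕ} (Φ : ℝ → Euc n → Euc n) (Cp : Set (Euc n)) : Prop :=
  ∀ t : ℝ, 0 < t → ∀ x y : Euc n,
    (coneLe Cp (Φ t x) (Φ t y) → coneLe Cp x y) ∧
    (coneLt Cp (Φ t x) (Φ t y) → coneLL Cp x y)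

/-- `D` is invariant under the flow. -/
def Invariant {n : ℕ} (Φ : ℝ → Euc n → Euc n) (D : Set (Euc n)) : Prop :=
  ∀ t : ℝ, Φ t '' D = D

/-- (H2): `Γ` is a compact invariant attractor uniformly attracting all compact sets. -/
def Dissipative {n : ℕ} (Φ : ℝ → Euc n → Euc n) (Γ : Set (Euc n)) : Prop :=
  Γ.Nonempty ∧ IsCompact Γ ∧ Invariant Φ Γ ∧
  ∀ N : Set (Euc n), IsCompact N → ∀ ε > 0, ∃ T : ℝ, ∀ t ≥ T, ∀ x ∈ N,
    Metric.infDist (Φ t x) Γ < ε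

/-- The ω-limit set of `x`. -/
def omegaSet {n : ℕ} (Φ : ℝ → Euc n → Euc n) (x : Euc n) : Set (Euc n) :=
  ⋂ t ∈ Ici (0 : ℝ), closure ((fun τ => Φ τ x) '' Ici t)

/-- The α-limit set of `x`. -/
def alphaSet {n : ℕ} (Φ : ℝ → Euc n → Euc n) (x : Euc n) : Set (Euc n) :=
  ⋂ t ∈ Iic (0 : ℝ), closure ((fun τ => Φ τ x) '' Iic t)

/-- The set `R(Φ)` of recurrent points. -/
def recurrentSet {n : ℕ} (Φ : ℝ → Euc n → Euc n) : Set (Euc n) :=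
  {x | x ∈ omegaSet Φ x}

/-- The Birkhoff center `𝓑(Φ)`. -/
def birkhoffCenter {n : ℕ} (Φ : ℝ → Euc n → Euc n) : Set (Euc n) :=
  closure (recurrentSet Φ)

/-- The set `E` of equilibria. -/
def equilibria {n : ℕ} (Φ : ℝ → Euc n → Euc n) : Set (Euc n) :=
  {p | ∀ t : ℝ, Φ t p = p}

/-- `C = C⁺ ∪ (−C⁺)`. -/
def coneC {n : ℕ} (Cp : Set (Euc n)) : Set (Euc n) := Cp ∪ (-Cp)

/-- `K = closure(ℝⁿ \ C)`. -/
def coneK {n : ℕ} (Cp : Set (Euc n)) : Set (Euc n) := closure ((coneC Cp)ᶜ)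

/-- The translated cone `C_x = x + C`. -/
def coneCAt {n : ℕ} (Cp : Set (Euc n)) (x : Euc n) : Set (Euc n) := {y | y - x ∈ coneC Cp}

/-- The translated complementary cone `K_x = x + K`. -/
def coneKAt {n : ℕ} (Cp : Set (Euc n)) (x : Euc n) : Set (Euc n) := {y | y - x ∈ coneK Cp}


/-- The lower boundary `∂₋S`. -/
def lowerBdry {n : ℕ} (Cp : Set (Euc n)) (S : Set (Euc n)) : Set (Euc n) :=
  {z | (∃ u : ℕ → Euc n, (∀ i, u i ∈ S) ∧ Filter.Tendsto u Filter.atTop (nhds z) ∧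
          ∀ i, coneLL Cp z (u i)) ∧
       ¬ ∃ v : ℕ → Euc n, (∀ i, v i ∈ S) ∧ Filter.Tendsto v Filter.atTop (nhds z) ∧
          ∀ i, coneLL Cp (v i) z}

/-- The upper boundary `∂₊S`. -/
def upperBdry {n : ℕ} (Cp : Set (Euc n)) (S : Set (Euc n)) : Set (Euc n) :=
  {z | (∃ v : ℕ → Euc n, (∀ i, v i ∈ S) ∧ Filter.Tendsto v Filter.atTop (nhds z) ∧
          ∀ i, coneLL Cp (v i) z) ∧
       ¬ ∃ u : ℕ → Euc n, (∀ i, u i ∈ S) ∧ Filter.Tendsto u Filter.atTop (nhds z) ∧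
          ∀ i, coneLL Cp z (u i)}

/-- The basin of repulsion `R(q)`. -/
def basinRep {n : ℕ} (Φ : ℝ → Euc n → Euc n) (q : Euc n) : Set (Euc n) :=
  {x | Filter.Tendsto (fun t : ℝ => Φ (-t) x) Filter.atTop (nhds q)}

/-- The basin of lower repulsion `R₋(q)`. -/
def basinRepLower {n : ℕ} (Φ : ℝ → Euc n → Euc n) (Cp : Set (Euc n)) (q : Euc n) :
    Set (Euc n) :=
  {x ∈ basinRep Φ q | ∃ T : ℝ, 0 < T ∧ ∀ t ≥ T, coneLL Cp (Φ (-t) x) q}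

/-- The basin of upper repulsion `R₊(q)`. -/
def basinRepUpper {n : ℕ} (Φ : ℝ → Euc n → Euc n) (Cp : Set (Euc n)) (q : Euc n) :
    Set (Euc n) :=
  {x ∈ basinRep Φ q | ∃ T : ℝ, 0 < T ∧ ∀ t ≥ T, coneLL Cp q (Φ (-t) x)}

/-- `M₋(q) = ∂₋R₋(q)`. -/
def Mminus {n : ℕ} (Φ : ℝ → Euc n → Euc n) (Cp : Set (Euc n)) (q : Euc n) : Set (Euc n) :=
  lowerBdry Cp (basinRepLower Φ Cp q)

/-- `M₊(p) = ∂₊R₊(p)`. -/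
def Mplus {n : ℕ} (Φ : ℝ → Euc n → Euc n) (Cp : Set (Euc n)) (p : Euc n) : Set (Euc n) :=
  upperBdry Cp (basinRepUpper Φ Cp p)

/-- `R(∞) = {x : |Φ_{−t}(x)| → ∞}`. -/
def repInfty {n : ℕ} (Φ : ℝ → Euc n → Euc n) : Set (Euc n) :=
  {x | Filter.Tendsto (fun t : ℝ => ‖Φ (-t) x‖) Filter.atTop Filter.atTop}

/-- `R₋(+∞) = Int R̃₋(+∞)`. -/
def RminusInfty {n : ℕ} (Φ : ℝ → Euc n → Euc n) (Cp : Set (Euc n)) (xlo : Euc n) :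
    Set (Euc n) :=
  interior {x ∈ repInfty Φ | ∃ T : ℝ, 0 < T ∧ ∀ t ≥ T, coneLL Cp xlo (Φ (-t) x)}

/-- `M₋(+∞) = ∂₋R₋(+∞)`. -/
def MminusInfty {n : ℕ} (Φ : ℝ → Euc n → Euc n) (Cp : Set (Euc n)) (xlo : Euc n) :
    Set (Euc n) :=
  lowerBdry Cp (RminusInfty Φ Cp xlo)

/-- `R₊(−∞) = Int R̃₊(−∞)`. -/
def RplusInfty {n : ℕ} (Φ : ℝ → Euc n → Euc n) (Cp : Set (Euc n)) (xhi : Euc n) :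
    Set (Euc n) :=
  interior {x ∈ repInfty Φ | ∃ T : ℝ, 0 < T ∧ ∀ t ≥ T, coneLL Cp (Φ (-t) x) xhi}

/-- `M₊(−∞) = ∂₊R₊(−∞)`. -/
def MplusInfty {n : ℕ} (Φ : ℝ → Euc n → Euc n) (Cp : Set (Euc n)) (xhi : Euc n) :
    Set (Euc n) :=
  upperBdry Cp (RplusInfty Φ Cp xhi)

/-- A continuous flow on an ordered space which is strongly monotone with respect to an open
relation `ll` playing the role of `≪`. -/
structure IsStronglyMonotoneFlow {X : Type*} [TopologicalSpace X] [PartialOrder X]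
    (ll : X → X → Prop) (Ψ : ℝ → X → X) : Prop where
  continuous : Continuous fun p : ℝ × X => Ψ p.1 p.2
  zero : ∀ x, Ψ 0 x = x
  add : ∀ t s x, Ψ t (Ψ s x) = Ψ (t + s) x
  isOpen_ll : IsOpen {p : X × X | ll p.1 p.2}
  le_of_ll : ∀ {x y}, ll x y → x ≤ y
  ll_of_lt : ∀ {t x y}, 0 < t → x < y → ll (Ψ t x) (Ψ t y)

/-- The limit set of the forward orbit of `z`. -/
def limitSet {X : Type*} [TopologicalSpace X] (Ψ : ℝ → X → X) (z : X) : Set X :=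
  {p | MapClusterPt p atTop fun t : ℝ => Ψ t z}

/-- The points that are recurrent in backward time. -/
def backwardRecurrent {X : Type*} [TopologicalSpace X] (Ψ : ℝ → X → X) : Set X :=
  {r | MapClusterPt r atTop fun t => Ψ (-t) r}

section LimitSet

variable {X : Type*} [TopologicalSpace X] {Ψ : ℝ → X → X}

theorem mem_limitSet_of_tendsto {p z : X} {u : ℕ → ℝ} (hu : Tendsto u atTop atTop)
    (hp : Tendsto (fun k => Ψ (u k) z) atTop (𝓝 p)) : p ∈ limitSet Ψ z :=
  MapClusterPt.of_comp hu hp.mapClusterPt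

theorem isClosed_limitSet (z : X) : IsClosed (limitSet Ψ z) := isClosed_setOfPred_clusterPt

theorem limitSet_subset_of_mem {K : Set X} (hK : IsClosed K)
    {z : X} (hz : ∀ t, Ψ t z ∈ K) : limitSet Ψ z ⊆ K := fun _ hp =>
  hK.mem_of_mapClusterPt hp (Eventually.of_forall hz)

theorem limitSet_nonempty {K : Set X} (hK : IsCompact K)
    {z : X} (hz : ∀ t, Ψ t z ∈ K) : (limitSet Ψ z).Nonempty := by
  obtain ⟨p, -, hp⟩ := hK.exists_mapClusterPt (f := atTop) (u := fun t : ℝ => Ψ t z)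
    (tendsto_principal.2 (Eventually.of_forall hz))
  exact ⟨p, hp⟩

end LimitSet

namespace IsStronglyMonotoneFlow

variable {X : Type*} [TopologicalSpace X] [PartialOrder X] {ll : X → X → Prop} {Ψ : ℝ → X → X}

theorem continuous_apply (h : IsStronglyMonotoneFlow ll Ψ) (t : ℝ) : Continuous (Ψ t) :=
  h.continuous.comp (by fun_prop : Continuous fun x : X => (t, x))

theorem continuous_orbit (h : IsStronglyMonotoneFlow ll Ψ) (x : X) :
    Continuous fun t => Ψ t x :=
  h.continuous.comp (by fun_prop : Continuous fun t : ℝ => (t, x))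

theorem apply_neg (h : IsStronglyMonotoneFlow ll Ψ) (t : ℝ) (x : X) : Ψ t (Ψ (-t) x) = x := by
  rw [h.add, add_neg_cancel, h.zero]

theorem mono (h : IsStronglyMonotoneFlow ll Ψ) {t : ℝ} (ht : 0 ≤ t) {x y : X} (hxy : x ≤ y) :
    Ψ t x ≤ Ψ t y := by
  rcases ht.eq_or_lt with rfl | ht
  · simpa only [h.zero] using hxy
  rcases hxy.eq_or_lt with rfl | hxy
  · exact le_rfl
  · exact h.le_of_ll (h.ll_of_lt ht hxy)

/-- The same flow for the opposite order. -/
theorem dual (h : IsStronglyMonotoneFlow ll Ψ) :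
    IsStronglyMonotoneFlow (X := Xᵒᵈ) (fun x y => ll y x) Ψ where
  continuous := h.continuous
  zero := h.zero
  add := h.add
  isOpen_ll := h.isOpen_ll.preimage (continuous_swap (X := X) (Y := X))
  le_of_ll := fun hxy => h.le_of_ll hxy
  ll_of_lt := fun ht hxy => h.ll_of_lt ht hxy

theorem eventually_ll (h : IsStronglyMonotoneFlow ll Ψ) {ι : Type*} {l : Filter ι} {f g : ι → X}
    {a b : X} (hab : ll a b) (hf : Tendsto f l (𝓝 a)) (hg : Tendsto g l (𝓝 b)) :
    ∀ᶠ i in l, ll (f i) (g i) :=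
  (hf.prodMk_nhds hg).eventually (h.isOpen_ll.mem_nhds hab)

theorem exists_seq (h : IsStronglyMonotoneFlow ll Ψ) [FirstCountableTopology X] {p z : X}
    (hp : p ∈ limitSet Ψ z) :
    ∃ u : ℕ → ℝ, Tendsto u atTop atTop ∧
      ∀ s, Tendsto (fun k => Ψ (s + u k) z) atTop (𝓝 (Ψ s p)) := by
  obtain ⟨u, hup, hu⟩ := MapClusterPt.exists_seq_tendsto hp
  refine ⟨u, hu, fun s => ?_⟩
  simpa only [Function.comp_def, h.add] using ((h.continuous_apply s).tendsto p).comp hup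

theorem apply_mem_limitSet (h : IsStronglyMonotoneFlow ll Ψ) {p z : X} (hp : p ∈ limitSet Ψ z)
    (s : ℝ) : Ψ s p ∈ limitSet Ψ z := by
  have h1 : MapClusterPt (Ψ s p) atTop (fun t => Ψ (s + t) z) := by
    simpa only [Function.comp_def, h.add] using
      MapClusterPt.continuousAt_comp (h.continuous_apply s).continuousAt hp
  exact MapClusterPt.of_comp (tendsto_atTop_add_const_left atTop s tendsto_id) h1

theorem exists_subseq (h : IsStronglyMonotoneFlow ll Ψ) [FirstCountableTopology X] {K : Set X}
    (hK : IsCompact K) {z : X} (hz : ∀ t, Ψ t z ∈ K) {u : ℕ → ℝ} (hu : Tendsto u atTop atTop) :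
    ∃ p ∈ limitSet Ψ z, ∃ φ : ℕ → ℕ, StrictMono φ ∧
      ∀ s, Tendsto (fun k => Ψ (s + u (φ k)) z) atTop (𝓝 (Ψ s p)) := by
  obtain ⟨p, -, φ, hφ, hp⟩ := hK.tendsto_subseq fun k => hz (u k)
  refine ⟨p, mem_limitSet_of_tendsto (hu.comp hφ.tendsto_atTop) hp, φ, hφ, fun s => ?_⟩
  simpa only [Function.comp_def, h.add] using ((h.continuous_apply s).tendsto p).comp hp

theorem iterate_le (h : IsStronglyMonotoneFlow ll Ψ) {w : X} {τ : ℝ} (hτ : 0 ≤ τ)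
    (hw : w ≤ Ψ τ w) (n : ℕ) : w ≤ Ψ (n * τ) w := by
  induction n with
  | zero => simp [h.zero]
  | succ n ih =>
    refine hw.trans ((h.mono hτ ih).trans_eq ?_)
    rw [h.add]; push_cast; congr 1; ring

/-- If `w ≤ Ψ_τ w` for all `τ` in a nontrivial interval, then the same holds for all large `τ`. -/
theorem exists_forall_le (h : IsStronglyMonotoneFlow ll Ψ) {w : X} {T ε : ℝ} (hT : 0 < T)
    (hε : 0 < ε) (hw : ∀ τ ∈ Icc T (T + ε), w ≤ Ψ τ w) : ∃ N, ∀ t ≥ N, w ≤ Ψ t w := by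
  obtain ⟨m, hm⟩ := exists_nat_gt (T / ε)
  refine ⟨T * (m + 1), fun t ht => ?_⟩
  have hn : m + 1 ≤ ⌊t / T⌋₊ := Nat.le_floor (by rw [le_div_iff₀ hT]; push_cast; linarith)
  have h1 : (⌊t / T⌋₊ : ℝ) * T ≤ t :=
    (le_div_iff₀ hT).1 (Nat.floor_le (div_nonneg (by nlinarith [m.cast_nonneg (α := ℝ)]) hT.le))
  have h2 : t < (⌊t / T⌋₊ + 1) * T := (div_lt_iff₀ hT).1 (Nat.lt_floor_add_one _)
  have hn' : ((m : ℝ) + 1) ≤ ⌊t / T⌋₊ := by exact_mod_cast hn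
  set n := ⌊t / T⌋₊
  have hn0 : (0 : ℝ) < n := by linarith [m.cast_nonneg (α := ℝ)]
  rw [div_lt_iff₀ hε] at hm
  have hτ : t / n ∈ Icc T (T + ε) := by
    constructor
    · rw [le_div_iff₀ hn0]; linarith
    · rw [div_le_iff₀ hn0]; nlinarith
  have := h.iterate_le (hT.le.trans hτ.1) (hw _ hτ) n
  rwa [mul_div_cancel₀ _ hn0.ne'] at this

variable [OrderClosedTopology X]

/-- Limit sets are unordered. -/
theorem eq_of_mem_limitSet_of_le (h : IsStronglyMonotoneFlow ll Ψ) {z a c : X}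
    (ha : a ∈ limitSet Ψ z) (hc : c ∈ limitSet Ψ z) (hac : a ≤ c) : a = c := by
  by_contra hne
  have hll : ll (Ψ 1 a) (Ψ 1 c) := h.ll_of_lt one_pos (lt_of_le_of_ne hac hne)
  obtain ⟨U, hU, V, hV, hUV⟩ := mem_nhds_prod_iff.1 (h.isOpen_ll.mem_nhds hll)
  obtain ⟨t, ht⟩ := ((h.apply_mem_limitSet ha 1).frequently hU).exists
  obtain ⟨t', ht', htt⟩ :=
    (((h.apply_mem_limitSet hc 1).frequently hV).and_eventually (eventually_gt_atTop t)).exists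
  set w := Ψ t z with hw
  have hwT : ll w (Ψ (t' - t) w) := by
    have : Ψ (t' - t) w = Ψ t' z := by rw [hw, h.add, sub_add_cancel]
    rw [this]
    exact hUV (mk_mem_prod ht ht')
  have hev : ∀ᶠ τ in 𝓝 (t' - t), ll w (Ψ τ w) :=
    h.eventually_ll hwT tendsto_const_nhds ((h.continuous_orbit w).tendsto _)
  obtain ⟨ε, hε, hball⟩ := Metric.eventually_nhds_iff_ball.1 hev
  obtain ⟨N, hN⟩ := h.exists_forall_le (w := w) (sub_pos.2 htt) (half_pos hε) fun τ hτ =>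
    h.le_of_ll (hball τ (by
      rw [Metric.mem_ball, Real.dist_eq, abs_of_nonneg (by linarith [hτ.1])]
      linarith [hτ.2]))
  have key : ∀ r ≥ t, ∀ r' ≥ r + N, Ψ r z ≤ Ψ r' z := by
    intro r hr r' hr'
    have h1 := h.mono (sub_nonneg.2 hr) (hN (r' - r) (by linarith))
    rwa [hw, h.add, h.add, h.add, sub_add_cancel,
      show r - t + (r' - r) + t = r' by ring] at h1
  have hIci : ∀ p ∈ limitSet Ψ z, ∀ r ≥ t, Ψ r z ≤ p := fun p hp r hr =>
    isClosed_Ici.mem_of_mapClusterPt hp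
      ((eventually_ge_atTop (r + N)).mono fun r' hr' => key r hr r' hr')
  have hca : c ≤ a := isClosed_Iic.mem_of_mapClusterPt hc
    ((eventually_ge_atTop t).mono fun r hr => hIci a ha r hr)
  exact hne (le_antisymm hac hca)

/-- Colimiting principle. -/
theorem isFixed_of_tendsto (h : IsStronglyMonotoneFlow ll Ψ) {x z p : X} (hxz : ll x z)
    {u : ℕ → ℝ} (hu : Tendsto u atTop atTop)
    (hx : ∀ s, Tendsto (fun k => Ψ (s + u k) x) atTop (𝓝 (Ψ s p)))
    (hz : ∀ s, Tendsto (fun k => Ψ (s + u k) z) atTop (𝓝 (Ψ s p))) (t : ℝ) : Ψ t p = p := by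
  have hx' := hx 0
  have hz' := hz 0
  simp only [zero_add, h.zero] at hx' hz'
  have e1 : ∀ᶠ s in 𝓝 (0 : ℝ), ll (Ψ s x) z := by
    refine h.eventually_ll hxz ?_ tendsto_const_nhds
    simpa only [h.zero] using (h.continuous_orbit x).tendsto 0
  have e2 : ∀ᶠ s in 𝓝 (0 : ℝ), ll x (Ψ s z) := by
    refine h.eventually_ll hxz tendsto_const_nhds ?_
    simpa only [h.zero] using (h.continuous_orbit z).tendsto 0
  obtain ⟨ε, hε, hball⟩ := Metric.eventually_nhds_iff_ball.1 (e1.and e2)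
  have hsmall : ∀ s ∈ Metric.ball (0 : ℝ) ε, Ψ s p = p := by
    intro s hs
    obtain ⟨h1, h2⟩ := hball s hs
    refine le_antisymm (le_of_tendsto_of_tendsto (hx s) hz' ?_)
      (le_of_tendsto_of_tendsto hx' (hz s) ?_)
    · filter_upwards [hu.eventually_ge_atTop 0] with k hk
      rw [add_comm, ← h.add]
      exact h.mono hk (h.le_of_ll h1)
    · filter_upwards [hu.eventually_ge_atTop 0] with k hk
      rw [add_comm, ← h.add]
      exact h.mono hk (h.le_of_ll h2)
  obtain ⟨n, hn⟩ := exists_nat_gt (|t| / ε)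
  have hn0 : (0 : ℝ) < n := (by positivity : 0 ≤ |t| / ε).trans_lt hn
  have hτ : Ψ (t / n) p = p := hsmall _ (by
    rw [mem_ball_zero_iff, Real.norm_eq_abs, abs_div, abs_of_pos hn0, div_lt_iff₀ hn0]
    rwa [div_lt_iff₀ hε, mul_comm] at hn)
  have hiter : ∀ m : ℕ, Ψ (m * (t / n)) p = p := by
    intro m
    induction m with
    | zero => simp [h.zero]
    | succ m ih =>
      have : Ψ (m * (t / n)) (Ψ (t / n) p) = p := by rw [hτ, ih]
      rw [h.add] at this
      push_cast
      rwa [add_mul, one_mul]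
  simpa [mul_div_cancel₀ _ hn0.ne'] using hiter n

theorem isFixed_of_mem_inter (h : IsStronglyMonotoneFlow ll Ψ) [FirstCountableTopology X]
    {K : Set X} (hK : IsCompact K) {x z p : X} (hzK : ∀ t, Ψ t z ∈ K) (hxz : ll x z)
    (hpx : p ∈ limitSet Ψ x) (hpz : p ∈ limitSet Ψ z) (t : ℝ) : Ψ t p = p := by
  obtain ⟨u, hu, hux⟩ := h.exists_seq hpx
  obtain ⟨q, hq, φ, hφ, huz⟩ := h.exists_subseq hK hzK hu
  have hux' := fun s => (hux s).comp hφ.tendsto_atTop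
  have hpq : p ≤ q := by
    have h1 := hux' 0
    have h2 := huz 0
    simp only [zero_add, h.zero] at h1 h2
    refine le_of_tendsto_of_tendsto h1 h2 ?_
    filter_upwards [(hu.comp hφ.tendsto_atTop).eventually_ge_atTop 0] with k hk
    simp only [Function.comp_apply]
    exact h.mono hk (h.le_of_ll hxz)
  obtain rfl := h.eq_of_mem_limitSet_of_le hpz hq hpq
  exact h.isFixed_of_tendsto hxz (hu.comp hφ.tendsto_atTop) hux' huz t

theorem forall_apply_le (h : IsStronglyMonotoneFlow ll Ψ) {x z a c : X} {u : ℕ → ℝ}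
    (hu : Tendsto u atTop atTop)
    (hx : ∀ s, Tendsto (fun k => Ψ (s + u k) x) atTop (𝓝 (Ψ s a)))
    (hz : ∀ s, Tendsto (fun k => Ψ (s + u k) z) atTop (𝓝 (Ψ s c)))
    (hxz : x ≤ z) (hc : c ∉ limitSet Ψ x) {b : ℝ} (hb : 0 ≤ b) : Ψ b a ≤ c := by
  have hz0 := hz 0
  simp only [zero_add, h.zero] at hz0
  have haL : a ∈ limitSet Ψ x := by
    have h1 := hx 0
    simp only [zero_add, h.zero] at h1
    exact mem_limitSet_of_tendsto hu h1
  have hclosed : IsClosed {s | Ψ s a ≤ c} :=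
    isClosed_le (h.continuous_orbit a) continuous_const
  refine (hclosed.inter isClosed_Icc).Icc_subset_of_forall_exists_gt (a := 0) (b := b) ?_ ?_
    ⟨hb, le_rfl⟩
  · have h1 := hx 0
    simp only [zero_add, h.zero] at h1
    rw [mem_ofPred_eq, h.zero]
    refine le_of_tendsto_of_tendsto h1 hz0 ?_
    filter_upwards [hu.eventually_ge_atTop 0] with k hk
    exact h.mono hk hxz
  · rintro s ⟨hs, -⟩ y hy
    have hlt : Ψ s a < c := lt_of_le_of_ne hs fun heq =>
      hc (heq ▸ h.apply_mem_limitSet haL s)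
    have hll := h.ll_of_lt one_pos hlt
    have hev : ∀ᶠ r in 𝓝 s, ll (Ψ 1 (Ψ r a)) (Ψ 1 c) :=
      h.eventually_ll hll (((h.continuous_apply 1).comp (h.continuous_orbit a)).tendsto s)
        tendsto_const_nhds
    obtain ⟨r, hr, hsr, hry⟩ := ((hev.filter_mono nhdsWithin_le_nhds).and
      (Ioc_mem_nhdsGT (mem_Ioi.1 hy) : ∀ᶠ r in 𝓝[>] s, r ∈ Ioc s y)).exists
    refine ⟨r, ?_, hsr, hry⟩
    rw [h.add] at hr
    obtain ⟨K, hK⟩ := (h.eventually_ll hr (hx (1 + r)) (hz 1)).exists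
    refine le_of_tendsto_of_tendsto (hx r) hz0 ?_
    filter_upwards [hu.eventually_ge_atTop (1 + u K)] with k hk
    have h1 := h.mono (sub_nonneg.2 hk) (h.le_of_ll hK)
    rw [h.add, h.add, sub_add_cancel] at h1
    rwa [show u k - (1 + u K) + (1 + r + u K) = r + u k by ring] at h1

/-- Absorption principle. -/
theorem le_limitSet_of_lt (h : IsStronglyMonotoneFlow ll Ψ) {K : Set X} (hK : IsCompact K)
    (hinv : ∀ t, ∀ p ∈ K, Ψ t p ∈ K) {z c : X} (hc : c ∈ limitSet Ψ z) (hlt : ∀ p ∈ K, p < c) :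
    ∀ p ∈ K, ∀ q ∈ limitSet Ψ z, p ≤ q := by
  have hev : ∀ᶠ c' in 𝓝 (Ψ 1 c), ∀ p ∈ K, ll p c' := by
    refine hK.eventually_forall_of_forall_eventually fun p hp => ?_
    have hll : ll p (Ψ 1 c) := by
      have := h.ll_of_lt one_pos (hlt _ (hinv (-1) p hp))
      rwa [h.apply_neg] at this
    exact h.eventually_ll hll continuousAt_snd continuousAt_fst
  obtain ⟨s, hs⟩ := ((h.apply_mem_limitSet hc 1).frequently hev).exists
  intro p hp q hq
  refine isClosed_Ici.mem_of_mapClusterPt hq ((eventually_ge_atTop s).mono fun t ht => ?_)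
  have h1 := h.mono (sub_nonneg.2 ht) (h.le_of_ll (hs _ (hinv (-(t - s)) p hp)))
  rwa [h.apply_neg, h.add, sub_add_cancel] at h1

theorem limitSet_lt_of_notMem (h : IsStronglyMonotoneFlow ll Ψ) [FirstCountableTopology X]
    {K : Set X} (hK : IsCompact K) {x z c : X} (hxK : ∀ t, Ψ t x ∈ K) (hzK : ∀ t, Ψ t z ∈ K)
    (hxz : ll x z) (hc : c ∈ limitSet Ψ z) (hcx : c ∉ limitSet Ψ x) :
    ∀ p ∈ limitSet Ψ x, ∀ q ∈ limitSet Ψ z, p < q := by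
  obtain ⟨u, hu, huz⟩ := h.exists_seq hc
  obtain ⟨a, ha, φ, hφ, hux⟩ := h.exists_subseq hK hxK hu
  have haK : ∀ t, Ψ t a ∈ K := fun t =>
    limitSet_subset_of_mem hK.isClosed hxK (h.apply_mem_limitSet ha t)
  have hax : limitSet Ψ a ⊆ limitSet Ψ x :=
    limitSet_subset_of_mem (isClosed_limitSet x) (h.apply_mem_limitSet ha)
  have hcompact : ∀ y, (∀ t, Ψ t y ∈ K) → IsCompact (limitSet Ψ y) := fun y hy =>
    hK.of_isClosed_subset (isClosed_limitSet y) (limitSet_subset_of_mem hK.isClosed hy)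
  have hac : ∀ p ∈ limitSet Ψ a, p < c := fun p hp =>
    lt_of_le_of_ne
      (isClosed_Iic.mem_of_mapClusterPt hp ((eventually_ge_atTop 0).mono fun b hb =>
        h.forall_apply_le (hu.comp hφ.tendsto_atTop) hux
          (fun s => (huz s).comp hφ.tendsto_atTop) (h.le_of_ll hxz) hcx hb))
      fun heq => hcx (heq ▸ hax hp)
  have hle := h.le_limitSet_of_lt (hcompact a haK) (fun t p hp => h.apply_mem_limitSet hp t) hc hac
  obtain ⟨p, hp⟩ := limitSet_nonempty hK haK
  have hpx := hax hp
  have hpz : ∀ q ∈ limitSet Ψ z, p < q := fun q hq =>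
    lt_of_le_of_ne (hle p hp q hq) fun heq => by
      subst heq
      exact (hac p hp).ne (h.eq_of_mem_limitSet_of_le hq hc (hac p hp).le)
  have hle' : ∀ p' ∈ limitSet Ψ x, ∀ q ∈ limitSet Ψ z, p' ≤ q := fun p' hp' q hq =>
    h.dual.le_limitSet_of_lt (K := limitSet Ψ z) (hcompact z hzK)
      (fun t p hp => h.apply_mem_limitSet hp t) hpx hpz q hq p' hp'
  intro p' hp' q hq
  refine lt_of_le_of_ne (hle' p' hp' q hq) fun heq => ?_
  subst heq
  exact (hpz p' hq).ne (h.eq_of_mem_limitSet_of_le hpx hp' (hle' p hpx p' hq))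

/-- Limit set dichotomy. -/
theorem limitSet_dichotomy (h : IsStronglyMonotoneFlow ll Ψ) [FirstCountableTopology X]
    {K : Set X} (hK : IsCompact K) {x z : X} (hxK : ∀ t, Ψ t x ∈ K) (hzK : ∀ t, Ψ t z ∈ K)
    (hxz : ll x z) :
    (limitSet Ψ x = limitSet Ψ z ∧ ∀ p ∈ limitSet Ψ z, ∀ t, Ψ t p = p) ∨
      ∀ p ∈ limitSet Ψ x, ∀ q ∈ limitSet Ψ z, p < q := by
  by_cases h1 : limitSet Ψ z ⊆ limitSet Ψ x
  · by_cases h2 : limitSet Ψ x ⊆ limitSet Ψ z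
    · exact Or.inl ⟨h2.antisymm h1, fun p hp => h.isFixed_of_mem_inter hK hzK hxz (h1 hp) hp⟩
    · obtain ⟨a, ha, haz⟩ := not_subset.1 h2
      have : FirstCountableTopology Xᵒᵈ := inferInstanceAs (FirstCountableTopology X)
      exact Or.inr fun p hp q hq =>
        h.dual.limitSet_lt_of_notMem (K := K) hK hzK hxK hxz ha haz q hq p hp
  · obtain ⟨c, hc, hcx⟩ := not_subset.1 h1
    exact Or.inr (h.limitSet_lt_of_notMem hK hxK hzK hxz hc hcx)

theorem isClosed_exists_le {A : Set X} (hA : IsCompact A) :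
    IsClosed {y | ∃ ζ ∈ A, y ≤ ζ} := by
  rw [← isOpen_compl_iff, isOpen_iff_eventually]
  intro y hy
  have hy' : ∀ ζ ∈ A, ¬ y ≤ ζ := fun ζ hζ hle => hy ⟨ζ, hζ, hle⟩
  have hev : ∀ᶠ y' in 𝓝 y, ∀ ζ ∈ A, ¬ y' ≤ ζ :=
    hA.eventually_forall_of_forall_eventually fun ζ hζ =>
      (OrderClosedTopology.isClosed_le' (α := X)).isOpen_compl.eventually_mem (hy' ζ hζ)
  exact hev.mono fun y' h' ⟨ζ, hζ, hle⟩ => h' ζ hζ hle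

theorem exists_le_limitSet (h : IsStronglyMonotoneFlow ll Ψ) [FirstCountableTopology X]
    {K : Set X} (hK : IsCompact K) {b z : X} (hzK : ∀ t, Ψ t z ∈ K)
    (hb : b ∈ closure (backwardRecurrent Ψ)) {s : ℝ} (hll : ll (Ψ s b) z) :
    ∃ ζ ∈ limitSet Ψ z, b ≤ ζ := by
  have hrec : ∀ r ∈ backwardRecurrent Ψ, ll (Ψ s r) z → ∃ ζ ∈ limitSet Ψ z, r ≤ ζ := by
    intro r hr hrz
    obtain ⟨u, hur, hu⟩ := MapClusterPt.exists_seq_tendsto hr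
    have hu' : Tendsto (fun k => u k - s) atTop atTop := tendsto_atTop_add_const_right _ _ hu
    have hev : ∀ᶠ k in atTop, ll (Ψ (-(u k - s)) r) z := by
      refine h.eventually_ll hrz ?_ tendsto_const_nhds
      have := ((h.continuous_apply s).tendsto r).comp hur
      simp only [Function.comp_def, h.add] at this
      simpa only [neg_sub, ← sub_eq_add_neg] using this
    obtain ⟨ζ, hζ, φ, hφ, hlim⟩ := h.exists_subseq hK hzK hu'
    refine ⟨ζ, hζ, ?_⟩
    have h0 := hlim 0
    simp only [zero_add, h.zero] at h0
    refine ge_of_tendsto h0 ?_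
    filter_upwards [hφ.tendsto_atTop.eventually hev,
      hφ.tendsto_atTop.eventually (hu'.eventually_ge_atTop 0)] with k hk hk0
    have := h.mono hk0 (h.le_of_ll hk)
    rwa [h.apply_neg] at this
  obtain ⟨r, hr, hrb⟩ := mem_closure_iff_seq_limit.1 hb
  have hev : ∀ᶠ k in atTop, ll (Ψ s (r k)) z :=
    h.eventually_ll hll (((h.continuous_apply s).tendsto b).comp hrb) tendsto_const_nhds
  have hrF : ∀ᶠ k in atTop, r k ∈ {y | ∃ ζ ∈ limitSet Ψ z, y ≤ ζ} :=
    hev.mono fun k hk => hrec _ (hr k) hk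
  exact (isClosed_exists_le (hK.of_isClosed_subset (isClosed_limitSet z)
    (limitSet_subset_of_mem hK.isClosed hzK))).mem_of_tendsto hrb hrF

theorem exists_ll_of_isPreconnected (h : IsStronglyMonotoneFlow ll Ψ) [FirstCountableTopology X]
    {A B : Set X} (hA : IsCompact A) (hAinv : ∀ t, ∀ p ∈ A, Ψ t p ∈ A)
    (hBrec : B ⊆ closure (backwardRecurrent Ψ)) (hBconn : IsPreconnected B)
    (hBinv : ∀ t, ∀ p ∈ B, Ψ t p ∈ B) (hAB : Disjoint A B) {b ζ : X} (hb : b ∈ B) (hζ : ζ ∈ A)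
    (hbζ : b ≤ ζ) : ∀ b' ∈ B, ∃ ζ' ∈ A, ll b' ζ' := by
  set F := {y | ∃ ζ ∈ A, y ≤ ζ}
  set O := ⋃ ζ ∈ A, {y | ll (Ψ 1 y) ζ}
  have hF : IsClosed F := isClosed_exists_le hA
  have hO : IsOpen O := isOpen_biUnion fun ζ _ =>
    h.isOpen_ll.preimage ((h.continuous_apply 1).prodMk continuous_const)
  have hFO : ∀ y ∈ B, y ∈ F → y ∈ O := by
    rintro y hy ⟨ζ, hζ, hle⟩
    exact mem_biUnion (hAinv 1 ζ hζ)
      (h.ll_of_lt one_pos (lt_of_le_of_ne hle (hAB.ne_of_mem hζ hy).symm))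
  have hOF : ∀ y ∈ B, y ∈ O → y ∈ F := by
    intro y hy hyO
    obtain ⟨ζ, hζ, hll⟩ := mem_iUnion₂.1 hyO
    have hζA : ∀ t, Ψ t ζ ∈ A := fun t => hAinv t ζ hζ
    obtain ⟨ζ', hζ', hle⟩ := h.exists_le_limitSet hA hζA (hBrec hy) hll
    exact ⟨ζ', limitSet_subset_of_mem hA.isClosed hζA hζ', hle⟩
  have hBO : B ⊆ O := by
    intro y hy
    by_contra hyO
    obtain ⟨w, hw, hwO, hwF⟩ := hBconn O Fᶜ hO hF.isOpen_compl
      (fun w hw => (em (w ∈ F)).imp (hFO w hw) id) ⟨b, hb, hFO b hb ⟨ζ, hζ, hbζ⟩⟩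
      ⟨y, hy, fun hyF => hyO (hFO y hy hyF)⟩
    exact hwF (hOF w hw hwO)
  intro b' hb'
  obtain ⟨ζ', hζ', hll⟩ := mem_iUnion₂.1 (hBO (hBinv (-1) b' hb'))
  rw [mem_ofPred_eq, h.apply_neg] at hll
  exact ⟨ζ', hζ', hll⟩

theorem disjoint_limitSet (h : IsStronglyMonotoneFlow ll Ψ) [FirstCountableTopology X]
    {K B : Set X} (hK : IsCompact K) (hKinv : ∀ t, ∀ p ∈ K, Ψ t p ∈ K) (hBK : B ⊆ K)
    (hBrec : B ⊆ closure (backwardRecurrent Ψ)) (hBconn : IsPreconnected B) (hBcl : IsClosed B)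
    (hBinv : ∀ t, ∀ p ∈ B, Ψ t p ∈ B) (hBanti : ∀ x ∈ B, ∀ y ∈ B, x ≤ y → x = y)
    (hBnt : B.Nontrivial) {x z : X} (hx : x ∈ B) (hz : z ∈ K) (hxz : ll x z) :
    Disjoint (limitSet Ψ z) B := by
  have hzK : ∀ t, Ψ t z ∈ K := fun t => hKinv t z hz
  have hxB : ∀ t, Ψ t x ∈ B := fun t => hBinv t x hx
  have hLx : limitSet Ψ x ⊆ B := limitSet_subset_of_mem hBcl hxB
  have hbelow : ∀ y ∈ B, ll y z → ∃ ζ ∈ limitSet Ψ z, y ≤ ζ := fun y hy hyz =>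
    h.exists_le_limitSet hK hzK (hBrec hy) (s := 0) (by rwa [h.zero])
  refine disjoint_left.2 fun p hpz hpB => ?_
  rcases h.limitSet_dichotomy hK (fun t => hBK (hxB t)) hzK hxz with ⟨heq, hfix⟩ | hlt
  · obtain ⟨ζ, hζ, hxζ⟩ := hbelow x hx hxz
    obtain rfl := hBanti x hx ζ (hLx (heq ▸ hζ)) hxζ
    have hLz : limitSet Ψ z ⊆ {x} := heq ▸ limitSet_subset_of_mem isClosed_singleton (hfix x hζ)
    have hsub : ∀ y ∈ B, ll y z → y = x := fun y hy hyz => by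
      obtain ⟨ζ, hζ, hle⟩ := hbelow y hy hyz
      obtain rfl := hLz hζ
      exact hBanti y hy _ hx hle
    obtain ⟨y, hy, hyx⟩ := hBnt.exists_ne x
    obtain ⟨w, hw, hwz, hwx⟩ := hBconn {y | ll y z} {x}ᶜ
      (h.isOpen_ll.preimage (continuous_id.prodMk continuous_const)) isOpen_compl_singleton
      (fun w _ => (em (w = x)).imp (fun hwx : w = x => hwx ▸ hxz) id) ⟨x, hx, hxz⟩ ⟨y, hy, hyx⟩
    exact hwx (hsub w hw hwz)
  · obtain ⟨p', hp'⟩ := limitSet_nonempty hK fun t => hBK (hxB t)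
    have := hlt p' hp' p hpz
    exact this.ne (hBanti p' (hLx hp') p hpB this.le)

theorem exists_ll_mem (h : IsStronglyMonotoneFlow ll Ψ) [FirstCountableTopology X]
    {K B : Set X} (hK : IsCompact K) (hKinv : ∀ t, ∀ p ∈ K, Ψ t p ∈ K) (hBK : B ⊆ K)
    (hBrec : B ⊆ closure (backwardRecurrent Ψ)) (hBconn : IsPreconnected B) (hBcl : IsClosed B)
    (hBinv : ∀ t, ∀ p ∈ B, Ψ t p ∈ B) (hBanti : ∀ x ∈ B, ∀ y ∈ B, x ≤ y → x = y)
    (hBnt : B.Nontrivial) {x z : X} (hx : x ∈ B) (hz : z ∈ K) (hxz : ll x z) :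
    ∀ b ∈ B, ∃ ζ ∈ limitSet Ψ z, ll b ζ := by
  have hzK : ∀ t, Ψ t z ∈ K := fun t => hKinv t z hz
  obtain ⟨ζ, hζ, hxζ⟩ := h.exists_le_limitSet hK hzK (hBrec hx) (s := 0) (by rwa [h.zero])
  exact h.exists_ll_of_isPreconnected
    (hK.of_isClosed_subset (isClosed_limitSet z) (limitSet_subset_of_mem hK.isClosed hzK))
    (fun t p hp => h.apply_mem_limitSet hp t) hBrec hBconn hBinv
    (h.disjoint_limitSet hK hKinv hBK hBrec hBconn hBcl hBinv hBanti hBnt hx hz hxz) hx hζ hxζ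

/-- Among points of `K` decreasing strictly to a point `b` of an unordered nontrivial continuum of
the Birkhoff center, some have an equilibrium above `b` in their limit set. -/
theorem exists_fixed_mem_limitSet (h : IsStronglyMonotoneFlow ll Ψ) [FirstCountableTopology X]
    {K B : Set X} (hK : IsCompact K) (hKinv : ∀ t, ∀ p ∈ K, Ψ t p ∈ K) (hBK : B ⊆ K)
    (hBrec : B ⊆ closure (backwardRecurrent Ψ)) (hBconn : IsPreconnected B) (hBcl : IsClosed B)
    (hBinv : ∀ t, ∀ p ∈ B, Ψ t p ∈ B) (hBanti : ∀ x ∈ B, ∀ y ∈ B, x ≤ y → x = y)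
    (hBnt : B.Nontrivial) {b : X} (hb : b ∈ B) {y : ℕ → X} (hyK : ∀ n, y n ∈ K)
    (hyb : Tendsto y atTop (𝓝 b)) (hby : ∀ n, ll b (y n)) (hyy : ∀ m n, m < n → ll (y n) (y m)) :
    ∃ n, ∃ q ∈ limitSet Ψ (y n), (∀ t, Ψ t q = q) ∧ b < q := by
  by_contra hcon
  push Not at hcon
  have hyK' : ∀ n t, Ψ t (y n) ∈ K := fun n t => hKinv t _ (hyK n)
  have habove : ∀ n, ∀ b' ∈ B, ∃ ζ ∈ limitSet Ψ (y n), ll b' ζ := fun n =>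
    h.exists_ll_mem hK hKinv hBK hBrec hBconn hBcl hBinv hBanti hBnt hb (hyK n) (hby n)
  have hdisj : ∀ n, Disjoint (limitSet Ψ (y n)) B := fun n =>
    h.disjoint_limitSet hK hKinv hBK hBrec hBconn hBcl hBinv hBanti hBnt hb (hyK n) (hby n)
  have hlt : ∀ m n, m < n → ∀ p ∈ limitSet Ψ (y n), ∀ q ∈ limitSet Ψ (y m), p < q := by
    intro m n hmn
    refine (h.limitSet_dichotomy hK (hyK' n) (hyK' m) (hyy m n hmn)).resolve_left ?_
    rintro ⟨-, hfix⟩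
    obtain ⟨ζ, hζ, hbζ⟩ := habove m b hb
    exact hcon m ζ hζ (hfix ζ hζ)
      (lt_of_le_of_ne (h.le_of_ll hbζ) ((hdisj m).ne_of_mem hζ hb).symm)
  choose c hc using fun n => limitSet_nonempty hK (hyK' n)
  obtain ⟨e, heK, φ, hφ, hlim⟩ := hK.tendsto_subseq fun n =>
    limitSet_subset_of_mem hK.isClosed (hyK' n) (hc n)
  have hele : ∀ n, ∀ q ∈ limitSet Ψ (y n), e ≤ q := fun n q hq =>
    le_of_tendsto hlim ((hφ.tendsto_atTop.eventually_gt_atTop n).mono fun k hk =>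
      (hlt n (φ k) hk _ (hc _) q hq).le)
  have heΨ : ∀ t, e ≤ Ψ t e := fun t =>
    ge_of_tendsto (((h.continuous_apply t).tendsto e).comp hlim)
      (Eventually.of_forall fun k => hele (φ k) _ (h.apply_mem_limitSet (hc _) t))
  have hfix0 : ∀ t, 0 ≤ t → Ψ t e = e := fun t ht => by
    refine le_antisymm ?_ (heΨ t)
    simpa only [h.apply_neg] using h.mono ht (heΨ (-t))
  have hfix : ∀ t, Ψ t e = e := fun t => by
    rcases le_total 0 t with ht | ht
    · exact hfix0 t ht
    · have := h.apply_neg t e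
      rwa [hfix0 (-t) (neg_nonneg.2 ht)] at this
  have hBe : ∀ b' ∈ B, b' ≤ e := fun b' hb' =>
    ge_of_tendsto hlim (Eventually.of_forall fun k => by
      obtain ⟨ζ, hζ, hle⟩ := habove (φ k + 1) b' hb'
      exact (h.le_of_ll hle).trans (hlt _ _ (Nat.lt_succ_self _) ζ hζ _ (hc _)).le)
  have heB : e ∉ B := fun heB => by
    obtain ⟨b', hb', hne⟩ := hBnt.exists_ne e
    exact hne (hBanti b' hb' e heB (hBe b' hb'))
  obtain ⟨e', he', hbe⟩ := h.exists_ll_of_isPreconnected isCompact_singleton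
    (A := {e}) (fun t p hp => by obtain rfl := hp; exact hfix t) hBrec hBconn hBinv
    (disjoint_singleton_left.2 heB) hb rfl (hBe b hb) b hb
  rw [mem_singleton_iff.1 he'] at hbe
  obtain ⟨n, hn⟩ := (h.eventually_ll hbe hyb tendsto_const_nhds).exists
  have hce : c n ≤ e := isClosed_Iic.mem_of_mapClusterPt (hc n)
    ((eventually_ge_atTop 0).mono fun t ht => (h.mono ht (h.le_of_ll hn)).trans_eq (hfix t))
  exact absurd (hele (n + 1) _ (hc _))
    ((hlt n (n + 1) n.lt_succ_self _ (hc _) _ (hc n)).trans_le hce).not_ge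

end IsStronglyMonotoneFlow

namespace IsConeOrder

variable {n : ℕ} {Cp : Set (Euc n)}

theorem zero_mem (hC : IsConeOrder Cp) : (0 : Euc n) ∈ Cp :=
  (hC.2.2.2.2.symm ▸ mem_singleton (0 : Euc n) : (0 : Euc n) ∈ Cp ∩ -Cp).1

theorem eq_zero (hC : IsConeOrder Cp) {u : Euc n} (hu : u ∈ Cp) (hu' : -u ∈ Cp) : u = 0 :=
  (hC.2.2.2.2 ▸ ⟨hu, hu'⟩ : u ∈ ({0} : Set (Euc n)))

theorem add_mem_interior (hC : IsConeOrder Cp) {u v : Euc n} (hu : u ∈ interior Cp)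
    (hv : v ∈ Cp) : u + v ∈ interior Cp := by
  have hopen : IsOpen ((fun w => w - v) ⁻¹' interior Cp) :=
    isOpen_interior.preimage (by fun_prop)
  refine interior_maximal (fun w hw => ?_) hopen (by simpa using hu)
  simpa using hC.2.1 _ (interior_subset hw) _ hv

theorem smul_mem_interior (hC : IsConeOrder Cp) {v : Euc n} (hv : v ∈ interior Cp) {c : ℝ}
    (hc : 0 < c) : c • v ∈ interior Cp := by
  have hsub : c • Cp ⊆ Cp := by
    rintro _ ⟨w, hw, rfl⟩
    exact hC.2.2.1 c hc w hw
  refine interior_mono hsub ?_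
  rw [interior_smul₀ hc.ne']
  exact smul_mem_smul_set hv

/-- The partial order induced by the cone. -/
abbrev partialOrder (hC : IsConeOrder Cp) : PartialOrder (Euc n) where
  le := coneLe Cp
  le_refl x := by simpa [coneLe] using hC.zero_mem
  le_trans x y z hxy hyz := by
    simpa [coneLe] using hC.2.1 _ hyz _ hxy
  le_antisymm x y hxy hyx :=
    (sub_eq_zero.1 (hC.eq_zero hxy (by rw [neg_sub]; exact hyx))).symm

theorem orderClosedTopology (hC : IsConeOrder Cp) :
    @OrderClosedTopology (Euc n) _ hC.partialOrder.toPreorder :=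
  letI := hC.partialOrder
  ⟨hC.1.preimage (by fun_prop : Continuous fun p : Euc n × Euc n => p.2 - p.1)⟩

/-- The cone is normal. -/
theorem exists_mul_norm_le (hC : IsConeOrder Cp) :
    ∃ δ > 0, ∀ u ∈ Cp, ∀ v ∈ Cp, δ * ‖u‖ ≤ ‖u + v‖ := by
  have hS : IsCompact (Cp ∩ sphere 0 1) := (isCompact_sphere 0 1).inter_left hC.1
  have hcl : IsClosed (Cp ∩ sphere 0 1 + Cp) := hC.1.add_left_of_isCompact hS
  have h0 : (0 : Euc n) ∉ Cp ∩ sphere 0 1 + Cp := by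
    rintro ⟨u, ⟨hu, hu1⟩, v, hv, huv⟩
    have hvu : v = -u := by
      rw [eq_neg_iff_add_eq_zero, add_comm]
      exact huv
    rw [hC.eq_zero hu (hvu ▸ hv)] at hu1
    simp at hu1
  obtain ⟨δ, hδ, hball⟩ := Metric.isOpen_iff.1 hcl.isOpen_compl 0 h0
  refine ⟨δ, hδ, fun u hu v hv => ?_⟩
  rcases eq_or_ne u 0 with rfl | hne
  · simp
  have hpos : 0 < ‖u‖ := norm_pos_iff.2 hne
  by_contra! hlt
  have hmem : ‖u‖⁻¹ • (u + v) ∈ ball (0 : Euc n) δ := by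
    rw [mem_ball_zero_iff, norm_smul, norm_inv, norm_norm, inv_mul_lt_iff₀ hpos, mul_comm]
    exact hlt
  refine hball hmem ?_
  rw [smul_add]
  refine add_mem_add ⟨hC.2.2.1 _ (inv_pos.2 hpos) u hu, ?_⟩ (hC.2.2.1 _ (inv_pos.2 hpos) v hv)
  rw [mem_sphere_zero_iff_norm, norm_smul, norm_inv, norm_norm, inv_mul_cancel₀ hpos.ne']

theorem exists_norm_le (hC : IsConeOrder Cp) {K : Set (Euc n)} (hK : IsCompact K) :
    ∃ R, ∀ x ∈ K, ∀ w ∈ K, ∀ z, coneLe Cp x z → coneLe Cp z w → ‖z‖ ≤ R := by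
  obtain ⟨δ, hδ, hnorm⟩ := hC.exists_mul_norm_le
  obtain ⟨M, hM⟩ := hK.isBounded.exists_norm_le
  refine ⟨(M + M) / δ + M, fun x hx w hw z hxz hzw => ?_⟩
  have h1 := hnorm _ hxz _ hzw
  rw [sub_add_sub_cancel'] at h1
  have h2 : ‖z - x‖ ≤ (M + M) / δ := by
    rw [le_div_iff₀ hδ, mul_comm]
    exact h1.trans ((norm_sub_le _ _).trans (add_le_add (hM w hw) (hM x hx)))
  calc ‖z‖ = ‖z - x + x‖ := by rw [sub_add_cancel]
    _ ≤ ‖z - x‖ + ‖x‖ := norm_add_le _ _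
    _ ≤ _ := add_le_add h2 (hM x hx)

theorem exists_antitone_seq (hC : IsConeOrder Cp) (x : Euc n) :
    ∃ y : ℕ → Euc n, Tendsto y atTop (𝓝 x) ∧ (∀ k, coneLL Cp x (y k)) ∧
      ∀ k l, k < l → coneLL Cp (y l) (y k) := by
  obtain ⟨v, hv⟩ := hC.2.2.2.1
  refine ⟨fun k => x + (1 / ((k : ℝ) + 1)) • v, ?_, fun k => ?_, fun k l hkl => ?_⟩
  · simpa using ((tendsto_one_div_add_atTop_nhds_zero_nat (𝕜 := ℝ)).smul_const v).const_add x
  · rw [coneLL, add_sub_cancel_left]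
    exact hC.smul_mem_interior hv (by positivity)
  · rw [coneLL, add_sub_add_left_eq_sub, ← sub_smul]
    exact hC.smul_mem_interior hv (sub_pos.2 (Nat.one_div_lt_one_div hkl))

end IsConeOrder

section CompetitiveFlow

variable {n : ℕ} {Φ : ℝ → Euc n → Euc n} {Cp Γ : Set (Euc n)}

theorem isStronglyMonotoneFlow_neg (hΦ : IsFlow Φ) (hC : IsConeOrder Cp)
    (hcomp : StronglyCompetitive Φ Cp) :
    @IsStronglyMonotoneFlow (Euc n) _ hC.partialOrder (coneLL Cp) fun t x => Φ (-t) x := by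
  let := hC.partialOrder
  have hcancel : ∀ t x, Φ t (Φ (-t) x) = x := fun t x => by
    rw [hΦ.2.2, add_neg_cancel, hΦ.2.1]
  refine ⟨hΦ.1.comp (by fun_prop : Continuous fun p : ℝ × Euc n => (-p.1, p.2)), fun x => ?_,
    fun t s x => ?_, ?_, fun hxy => interior_subset hxy, fun {t x y} ht hxy => ?_⟩
  · rw [neg_zero, hΦ.2.1]
  · rw [hΦ.2.2, neg_add]
  · exact isOpen_interior.preimage (by fun_prop : Continuous fun p : Euc n × Euc n => p.2 - p.1)
  · refine (hcomp t ht _ _).2 ?_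
    rw [hcancel, hcancel]
    exact ⟨hxy.le, hxy.ne'⟩

theorem alphaSet_eq_limitSet (z : Euc n) :
    alphaSet Φ z = limitSet (fun t x => Φ (-t) x) z := by
  ext p
  simp only [alphaSet, limitSet, mem_iInter₂, mem_ofPred_eq, mapClusterPt_iff_frequently,
    mem_closure_iff_nhds, frequently_atTop]
  constructor
  · intro hp s hs a
    obtain ⟨_, hq, τ, hτ, rfl⟩ := hp (-|a|) (by simp) s hs
    refine ⟨-τ, ?_, by simpa using hq⟩
    linarith [le_abs_self a, mem_Iic.1 hτ]
  · intro hp t _ s hs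
    obtain ⟨b, hb, hbs⟩ := hp s hs (-t)
    exact ⟨_, hbs, -b, by simpa using neg_le.1 hb, rfl⟩

theorem mem_omegaSet_iff {x p : Euc n} :
    p ∈ omegaSet Φ x ↔ MapClusterPt p atTop fun t => Φ t x := by
  simp only [omegaSet, mem_iInter₂, mapClusterPt_iff_frequently,
    mem_closure_iff_nhds, frequently_atTop]
  constructor
  · intro hp s hs a
    obtain ⟨_, hq, τ, hτ, rfl⟩ := hp |a| (by simp) s hs
    exact ⟨τ, (le_abs_self a).trans hτ, hq⟩
  · intro hp t _ s hs
    obtain ⟨b, hb, hbs⟩ := hp s hs t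
    exact ⟨_, hbs, b, hb, rfl⟩

theorem recurrentSet_eq_backwardRecurrent :
    recurrentSet Φ = backwardRecurrent fun t x => Φ (-t) x := by
  ext x
  simp only [recurrentSet, backwardRecurrent, mem_ofPred_eq,
    mem_omegaSet_iff, neg_neg]

theorem Dissipative.apply_mem (hΓ : Dissipative Φ Γ) (t : ℝ) {x : Euc n} (hx : x ∈ Γ) :
    Φ t x ∈ Γ :=
  hΓ.2.2.1 t ▸ mem_image_of_mem _ hx

theorem Dissipative.mem_of_infDist (hΓ : Dissipative Φ Γ) {x : Euc n}
    (hx : ∀ ε > 0, infDist x Γ ≤ ε) : x ∈ Γ :=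
  (hΓ.2.1.isClosed.mem_iff_infDist_zero hΓ.1).2
    (le_antisymm (le_of_forall_pos_le_add fun ε hε => by simpa using hx ε hε) infDist_nonneg)

theorem mem_of_notMem_repInfty (hΦ : IsFlow Φ) (hΓ : Dissipative Φ Γ) {z : Euc n}
    (hz : z ∉ repInfty Φ) : z ∈ Γ := by
  have hz' : ¬ Tendsto (fun t : ℝ => ‖Φ (-t) z‖) atTop atTop := hz
  rw [Filter.tendsto_atTop] at hz'
  push Not at hz'
  obtain ⟨R, hR⟩ := hz'
  refine hΓ.mem_of_infDist fun ε hε => ?_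
  obtain ⟨T, hT⟩ := hΓ.2.2.2 _ (isCompact_closedBall 0 R) ε hε
  obtain ⟨t, ht, htT⟩ := (hR.and_eventually (eventually_ge_atTop T)).exists
  have := hT t htT (Φ (-t) z) (mem_closedBall_zero_iff.2 ht.le)
  rw [hΦ.2.2, add_neg_cancel, hΦ.2.1] at this
  exact this.le

theorem notMem_repInfty (hΓ : Dissipative Φ Γ) {z : Euc n} (hz : z ∈ Γ) : z ∉ repInfty Φ := by
  intro hz'
  obtain ⟨M, hM⟩ := hΓ.2.1.isBounded.exists_norm_le
  have hz' : Tendsto (fun t : ℝ => ‖Φ (-t) z‖) atTop atTop := hz'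
  obtain ⟨t, ht⟩ := (hz'.eventually_ge_atTop (M + 1)).exists
  linarith [hM _ (hΓ.apply_mem (-t) hz)]

theorem mem_of_mem_alphaSet (hΦ : IsFlow Φ) (hΓ : Dissipative Φ Γ) {z p : Euc n}
    (hp : p ∈ alphaSet Φ z) : z ∈ Γ := by
  refine mem_of_notMem_repInfty hΦ hΓ fun hz => ?_
  rw [alphaSet_eq_limitSet] at hp
  have hp' : MapClusterPt ‖p‖ atTop fun t => ‖Φ (-t) z‖ :=
    MapClusterPt.continuousAt_comp continuous_norm.continuousAt hp
  obtain ⟨t, ht, ht'⟩ := ((hp'.frequently (gt_mem_nhds (lt_add_one ‖p‖))).and_eventually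
    (Filter.tendsto_atTop.1 (show Tendsto (fun t : ℝ => ‖Φ (-t) z‖) atTop atTop from hz)
      (‖p‖ + 1))).exists
  exact absurd ht ht'.not_gt

theorem recurrentSet_subset (hΓ : Dissipative Φ Γ) : recurrentSet Φ ⊆ Γ := by
  intro r hr
  have hr' := mem_omegaSet_iff.1 hr
  refine hΓ.mem_of_infDist fun ε hε => ?_
  obtain ⟨T, hT⟩ := hΓ.2.2.2 _ isCompact_singleton ε hε
  exact (isClosed_le (continuous_infDist_pt Γ) continuous_const).mem_of_mapClusterPt hr'
    ((eventually_ge_atTop T).mono fun t ht => (hT t ht r rfl).le)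

theorem birkhoffCenter_subset (hΓ : Dissipative Φ Γ) : birkhoffCenter Φ ⊆ Γ :=
  closure_minimal (recurrentSet_subset hΓ) hΓ.2.1.isClosed

theorem apply_mem_birkhoffCenter (hΦ : IsFlow Φ) (t : ℝ) {x : Euc n}
    (hx : x ∈ birkhoffCenter Φ) : Φ t x ∈ birkhoffCenter Φ := by
  have hcont : Continuous (Φ t) := hΦ.1.comp (by fun_prop : Continuous fun x : Euc n => (t, x))
  refine map_mem_closure hcont hx fun r hr => mem_omegaSet_iff.2 ?_
  have := MapClusterPt.continuousAt_comp hcont.continuousAt (mem_omegaSet_iff.1 hr)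
  simpa only [Function.comp_def, hΦ.2.2, add_comm t] using this

theorem apply_mem_connectedComponentIn (hΦ : IsFlow Φ) {x₀ x : Euc n} (t : ℝ)
    (hx : x ∈ connectedComponentIn (birkhoffCenter Φ) x₀) :
    Φ t x ∈ connectedComponentIn (birkhoffCenter Φ) x₀ := by
  have hxB := connectedComponentIn_subset _ _ hx
  rw [connectedComponentIn_eq hx]
  refine (isPreconnected_range (hΦ.1.comp
    (by fun_prop : Continuous fun s : ℝ => (s, x)))).subset_connectedComponentIn
    ⟨0, hΦ.2.1 x⟩ ?_ ⟨t, rfl⟩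
  rintro _ ⟨s, rfl⟩
  exact apply_mem_birkhoffCenter hΦ s hxB

theorem isClosed_connectedComponentIn {X : Type*} [TopologicalSpace X] {F : Set X}
    (hF : IsClosed F) (x : X) : IsClosed (connectedComponentIn F x) := by
  by_cases hx : x ∈ F
  · refine isClosed_of_closure_subset ?_
    exact isPreconnected_connectedComponentIn.closure.subset_connectedComponentIn
      (subset_closure (mem_connectedComponentIn hx))
      (closure_minimal (connectedComponentIn_subset F x) hF)
  · rw [connectedComponentIn_eq_empty hx]
    exact isClosed_empty

theorem mem_of_coneLe_of_coneLe (hΦ : IsFlow Φ) (hC : IsConeOrder Cp)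
    (hcomp : StronglyCompetitive Φ Cp) (hΓ : Dissipative Φ Γ) {x z w : Euc n} (hx : x ∈ Γ)
    (hw : w ∈ Γ) (hxz : coneLe Cp x z) (hzw : coneLe Cp z w) : z ∈ Γ := by
  let := hC.partialOrder
  have h := isStronglyMonotoneFlow_neg hΦ hC hcomp
  obtain ⟨R, hR⟩ := hC.exists_norm_le hΓ.2.1
  refine mem_of_notMem_repInfty hΦ hΓ fun hz : Tendsto (fun t : ℝ => ‖Φ (-t) z‖) atTop atTop => ?_
  obtain ⟨t, ht, ht0⟩ :=
    ((hz.eventually_ge_atTop (R + 1)).and (eventually_ge_atTop 0)).exists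
  linarith [hR _ (hΓ.apply_mem (-t) hx) _ (hΓ.apply_mem (-t) hw) _ (h.mono ht0 hxz)
    (h.mono ht0 hzw)]

/-- Points strongly above a point of the attractor escape to `+∞` unless one of them lies in the
attractor. -/
theorem mem_RminusInfty (hΦ : IsFlow Φ) (hC : IsConeOrder Cp)
    (hcomp : StronglyCompetitive Φ Cp) (hΓ : Dissipative Φ Γ) {xlo : Euc n}
    (hlo : ∀ g ∈ Γ, coneLe Cp xlo g) {x z : Euc n} (hx : x ∈ Γ)
    (hxΓ : ∀ w ∈ Γ, ¬ coneLL Cp x w) (hxz : coneLL Cp x z) : z ∈ RminusInfty Φ Cp xlo := by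
  let := hC.partialOrder
  have h := isStronglyMonotoneFlow_neg hΦ hC hcomp
  have hopen : IsOpen {y | coneLL Cp x y} :=
    isOpen_interior.preimage (by fun_prop : Continuous fun y : Euc n => y - x)
  have hsub : {y | coneLL Cp x y} ⊆
      {y ∈ repInfty Φ | ∃ T : ℝ, 0 < T ∧ ∀ t ≥ T, coneLL Cp xlo (Φ (-t) y)} := by
    refine fun y hy => ⟨?_, 1, one_pos, fun t ht => ?_⟩
    · by_contra hy'
      exact hxΓ y (mem_of_notMem_repInfty hΦ hΓ hy') hy
    · have hll : coneLL Cp (Φ (-t) x) (Φ (-t) y) := by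
        rcases eq_or_ne x y with rfl | hne
        · have hy0 : coneLL Cp x x := hy
          simpa only [coneLL, sub_self] using hy0
        · exact h.ll_of_lt (by linarith) (lt_of_le_of_ne (h.le_of_ll hy) hne)
      have := hC.add_mem_interior hll (hlo _ (hΓ.apply_mem (-t) hx))
      rwa [sub_add_sub_cancel] at this
  exact interior_maximal hsub hopen hxz

theorem notMem_of_mem_RminusInfty (hΓ : Dissipative Φ Γ) {xlo z : Euc n}
    (hz : z ∈ RminusInfty Φ Cp xlo) : z ∉ Γ := fun hzΓ =>
  notMem_repInfty hΓ hzΓ (interior_subset hz).1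

end CompetitiveFlow

theorem stmt17 {n : ℕ} (Φ : ℝ → Euc n → Euc n) (Cp Γ : Set (Euc n))
    (hΦ : IsFlow Φ) (hC : IsConeOrder Cp) (hcomp : StronglyCompetitive Φ Cp)
    (hΓ : Dissipative Φ Γ)
    (xlo : Euc n) (hlo : ∀ g ∈ Γ, coneLe Cp xlo g)
    (B : Set (Euc n)) (x₀ : Euc n) (hx₀ : x₀ ∈ birkhoffCenter Φ)
    (hB : B = connectedComponentIn (birkhoffCenter Φ) x₀)
    (hBu : Unordered Cp B)
    (B₁ B₂ : Set (Euc n))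
    (hB₁ : B₁ = {x ∈ B | ∃ z : ℕ → Euc n, ∃ q : ℕ → Euc n,
      Filter.Tendsto z Filter.atTop (nhds x) ∧ (∀ i, coneLL Cp x (z i)) ∧
      ∀ i, q i ∈ alphaSet Φ (z i) ∩ equilibria Φ ∧ coneLt Cp x (q i)})
    (hB₂ : B₂ = {x ∈ B | ∃ z : ℕ → Euc n, (∀ i, z i ∈ RminusInfty Φ Cp xlo) ∧
      Filter.Tendsto z Filter.atTop (nhds x) ∧ ∀ i, coneLL Cp x (z i)}) :
    ((B₁.Nonempty → B₂ = ∅) ∧ (B₂.Nonempty → B₁ = ∅)) ∧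
    ((B₁.Nonempty → B ⊆ closure B₁) ∧ (B₂.Nonempty → B ⊆ closure B₂)) := by
  let := hC.partialOrder
  have := hC.orderClosedTopology
  have h := isStronglyMonotoneFlow_neg hΦ hC hcomp
  have hBK : B ⊆ Γ := hB ▸ (connectedComponentIn_subset _ _).trans (birkhoffCenter_subset hΓ)
  have hmem₁ : ∀ x ∈ B₁, x ∈ B ∧ ∃ w ∈ Γ, coneLL Cp x w := by
    intro x hx
    obtain ⟨hxB, z, q, -, hxz, hq⟩ := hB₁ ▸ hx
    exact ⟨hxB, z 0, mem_of_mem_alphaSet hΦ hΓ (hq 0).1.1, hxz 0⟩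
  have hmem₂ : ∀ x, x ∈ B₂ ↔ x ∈ B ∧ ∀ w ∈ Γ, ¬ coneLL Cp x w := by
    intro x
    rw [hB₂]
    constructor
    · rintro ⟨hxB, z, hz, hzx, hxz⟩
      refine ⟨hxB, fun w hw hxw => ?_⟩
      obtain ⟨i, hi⟩ := (h.eventually_ll hxw hzx tendsto_const_nhds).exists
      exact notMem_of_mem_RminusInfty hΓ (hz i) (mem_of_coneLe_of_coneLe hΦ hC hcomp hΓ (hBK hxB) hw
        (h.le_of_ll (hxz i)) (h.le_of_ll hi))
    · rintro ⟨hxB, hx⟩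
      obtain ⟨y, hyx, hxy, -⟩ := hC.exists_antitone_seq x
      exact ⟨hxB, y, fun i => mem_RminusInfty hΦ hC hcomp hΓ hlo (hBK hxB) hx (hxy i), hyx, hxy⟩
  suffices hmain : B₁.Nonempty ∨ B₂.Nonempty → (B₁ = B ∧ B₂ = ∅) ∨ (B₁ = ∅ ∧ B₂ = B) by
    refine ⟨⟨fun h₁ => ?_, fun h₂ => ?_⟩, fun h₁ => ?_, fun h₂ => ?_⟩
    · obtain ⟨-, h⟩ | ⟨h, -⟩ := hmain (.inl h₁)
      · exact h
      · exact absurd h h₁.ne_empty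
    · obtain ⟨-, h⟩ | ⟨h, -⟩ := hmain (.inr h₂)
      · exact absurd h h₂.ne_empty
      · exact h
    · obtain ⟨h, -⟩ | ⟨h, -⟩ := hmain (.inl h₁)
      · exact h ▸ subset_closure
      · exact absurd h h₁.ne_empty
    · obtain ⟨-, h⟩ | ⟨-, h⟩ := hmain (.inr h₂)
      · exact absurd h h₂.ne_empty
      · exact h ▸ subset_closure
  have hsub₁ : B₁ ⊆ B := fun x hx => (hmem₁ x hx).1
  have hsub₂ : B₂ ⊆ B := fun x hx => ((hmem₂ x).1 hx).1
  rcases B.subsingleton_or_nontrivial with hBs | hBnt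
  · rintro (⟨x, hx⟩ | ⟨x, hx⟩)
    · obtain ⟨hxB, w, hw, hxw⟩ := hmem₁ x hx
      refine .inl ⟨hsub₁.antisymm fun y hy => hBs hxB hy ▸ hx, eq_empty_of_forall_notMem ?_⟩
      exact fun y hy => ((hmem₂ y).1 hy).2 w hw (hBs (hsub₂ hy) hxB ▸ hxw)
    · refine .inr ⟨eq_empty_of_forall_notMem fun y hy => ?_,
        hsub₂.antisymm fun y hy => hBs (hsub₂ hx) hy ▸ hx⟩
      obtain ⟨hyB, w, hw, hyw⟩ := hmem₁ y hy
      exact ((hmem₂ x).1 hx).2 w hw (hBs hyB (hsub₂ hx) ▸ hyw)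
  have hKinv : ∀ t : ℝ, ∀ p ∈ Γ, Φ (-t) p ∈ Γ := fun t p hp => hΓ.apply_mem (-t) hp
  have hBrec : B ⊆ closure (backwardRecurrent fun t x => Φ (-t) x) := by
    rw [← recurrentSet_eq_backwardRecurrent, hB]
    exact connectedComponentIn_subset _ _
  have hBconn : IsPreconnected B := hB ▸ isPreconnected_connectedComponentIn
  have hBcl : IsClosed B := hB ▸ isClosed_connectedComponentIn isClosed_closure x₀
  have hBinv : ∀ t : ℝ, ∀ p ∈ B, Φ (-t) p ∈ B := by
    rw [hB]
    exact fun t p hp => apply_mem_connectedComponentIn hΦ (-t) hp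
  have hBanti : ∀ x ∈ B, ∀ y ∈ B, x ≤ y → x = y := fun x hx y hy hxy =>
    by_contra fun hne => hBu x hx y hy hne hxy
  by_cases hU : ∃ x ∈ B, ∃ w ∈ Γ, coneLL Cp x w
  · refine fun _ => .inl ⟨hsub₁.antisymm fun b hb => ?_, eq_empty_of_forall_notMem fun b hb => ?_⟩
    all_goals
      obtain ⟨x, hx, z, hz, hxz⟩ := hU
      have hbw := h.exists_ll_mem hΓ.2.1 hKinv hBK hBrec hBconn hBcl hBinv hBanti hBnt hx hz hxz b
    · obtain ⟨w, hw, hbw⟩ := hbw hb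
      replace hw : w ∈ Γ := limitSet_subset_of_mem hΓ.2.1.isClosed (hKinv · z hz) hw
      obtain ⟨y, hyb, hby, hyy⟩ := hC.exists_antitone_seq b
      obtain ⟨N, hN⟩ := eventually_atTop.1 (h.eventually_ll hbw hyb tendsto_const_nhds)
      have hyΓ : ∀ k ≥ N, y k ∈ Γ := fun k hk => mem_of_coneLe_of_coneLe hΦ hC hcomp hΓ (hBK hb) hw
        (h.le_of_ll (hby k)) (h.le_of_ll (hN k hk))
      have hex : ∀ i, ∃ k ≥ i, ∃ q ∈ limitSet (fun t x => Φ (-t) x) (y k),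
          (∀ t : ℝ, Φ (-t) q = q) ∧ b < q := by
        intro i
        obtain ⟨m, hm⟩ := h.exists_fixed_mem_limitSet (y := fun k => y (k + (i + N))) hΓ.2.1 hKinv
          hBK hBrec hBconn hBcl hBinv hBanti hBnt hb (fun k => hyΓ _ (by omega))
          (hyb.comp (tendsto_add_atTop_nat _)) (fun k => hby _) (fun k l hkl => hyy _ _ (by omega))
        exact ⟨m + (i + N), by omega, hm⟩
      choose k hk q hq hqfix hbq using hex
      rw [hB₁]
      refine ⟨hb, fun i => y (k i), q, hyb.comp (tendsto_atTop_mono hk tendsto_id),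
        fun i => hby _, fun i => ⟨⟨?_, fun t => ?_⟩, (hbq i).le, (hbq i).ne'⟩⟩
      · rw [alphaSet_eq_limitSet]
        exact hq i
      · simpa using hqfix i (-t)
    · obtain ⟨w, hw, hbw⟩ := hbw (hsub₂ hb)
      exact ((hmem₂ b).1 hb).2 w
        (limitSet_subset_of_mem hΓ.2.1.isClosed (hKinv · z hz) hw) hbw
  · push Not at hU
    exact fun _ => .inr ⟨eq_empty_of_forall_notMem fun x hx =>
        let ⟨hxB, w, hw, hxw⟩ := hmem₁ x hx; hU x hxB w hw hxw,
      hsub₂.antisymm fun x hx => (hmem₂ x).2 ⟨hx, hU x hx⟩⟩
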